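/- Let n ≥ 5 be an odd integer and let Δ be an integer whose Jacobi symbol satisfies (Δ/n) = −1. Consider the Pell conic over ℤ/nℤ with group operation P + Q = (2⁻¹(P₁Q₁ + Δ P₂Q₂), 2⁻¹(P₁Q₂ + P₂Q₁)) and neutral element N = (2,0), where multiples m·P mean m-fold iterated addition of P (i.e. applying the map Q ↦ P + Q to N exactly m times). Then n is prime if and only if there exists a point P = (x,y) ∈ (ℤ/nℤ)² with x² − Δy² = 4 such that (n+1)·P = N and ((n+1)/r)·P ≠ N for every prime r dividing n + 1. -/

import Mathlib

/-- The group law on the Pell conic `X² - ΔY² = 4` over `ℤ/nℤ`, written using the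
inverse of `2` (which exists since `n` is odd). -/
def pellAdd (n : ℕ) (Δ : ℤ) (P Q : ZMod n × ZMod n) : ZMod n × ZMod n :=
  ((2 : ZMod n)⁻¹ * (P.1 * Q.1 + (Δ : ZMod n) * P.2 * Q.2),
   (2 : ZMod n)⁻¹ * (P.1 * Q.2 + P.2 * Q.1))

open QuadraticAlgebra in
/-- Frobenius on a quadratic algebra `(ℤ/nℤ)[√Δ]`, modulo an odd prime `p`. -/
theorem QuadraticAlgebra.natCast_prime_dvd_pow_sub {n p : ℕ} (hp : p.Prime) (hp2 : p ≠ 2) (Δ : ℤ)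
    (z : QuadraticAlgebra (ZMod n) (Δ : ZMod n) 0) :
    (p : QuadraticAlgebra (ZMod n) (Δ : ZMod n) 0) ∣
      z ^ p - ⟨z.re, (jacobiSym Δ p : ZMod n) * z.im⟩ := by
  have : Fact p.Prime := ⟨hp⟩
  let R := QuadraticAlgebra (ZMod n) (Δ : ZMod n) 0
  have cast_dvd {a b : ℤ} (h : (a : ZMod p) = b) : (p : R) ∣ (a : R) - (b : R) := by
    have h' : (p : ℤ) ∣ a - b := by
      rw [← ZMod.intCast_zmod_eq_zero_iff_dvd]
      push_cast
      rw [h, sub_self]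
    simpa using map_dvd (Int.castRingHom R) h'
  have frobenius (a : ℤ) : (p : R) ∣ (a : R) ^ p - (a : R) := by
    have := cast_dvd (a := a ^ p) (b := a) (by push_cast; exact ZMod.pow_card _)
    simpa using this
  have euler : (p : R) ∣ (Δ : R) ^ (p / 2) - (jacobiSym Δ p : R) := by
    have := cast_dvd (a := Δ ^ (p / 2)) (b := jacobiSym Δ p) (by
      rw [← jacobiSym.legendreSym.to_jacobiSym, legendreSym.eq_pow]; push_cast; rfl)
    simpa using this
  obtain ⟨a, ha⟩ := ZMod.intCast_surjective z.re
  obtain ⟨b, hb⟩ := ZMod.intCast_surjective z.im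
  set w : R := ω
  have hz : z = (a : R) + b * w := by ext <;> simp [w, R, ha, hb]
  have hzp : (⟨z.re, (jacobiSym Δ p : ZMod n) * z.im⟩ : R) = a + jacobiSym Δ p * b * w := by
    ext <;> simp [w, R, ha, hb]
  have hw : w ^ p = (Δ : R) ^ (p / 2) * w := by
    have hw2 : w ^ 2 = (Δ : R) := by ext <;> simp [w, R, pow_two]
    conv_lhs => rw [← Nat.two_mul_div_two_add_one_of_odd (hp.odd_of_ne_two hp2)]
    rw [pow_succ, pow_mul, hw2]
  rw [hzp, hz]
  obtain ⟨r, hr⟩ := exists_add_pow_prime_eq hp (a : R) (b * w)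
  obtain ⟨u, hu⟩ := frobenius a
  obtain ⟨v, hv⟩ := frobenius b
  obtain ⟨t, ht⟩ := euler
  rw [hr, mul_pow, hw]
  refine ⟨u + v * (Δ : R) ^ (p / 2) * w + t * b * w + a * (b * w) * r, ?_⟩
  linear_combination hu + hv * (Δ : R) ^ (p / 2) * w + ht * b * w

/-- A norm-one element of `(ℤ/nℤ)[√Δ]` has order dividing `p - 1` or `p + 1` modulo an odd
prime `p ∤ Δ`. -/
theorem QuadraticAlgebra.exists_natCast_dvd_pow_sub_one {n p : ℕ} (hp : p.Prime) (hp2 : p ≠ 2)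
    {Δ : ℤ} (hΔ : jacobiSym Δ p ≠ 0) {z : QuadraticAlgebra (ZMod n) (Δ : ZMod n) 0}
    (hz : z * star z = 1) :
    ∃ d, Even d ∧ 0 < d ∧ d ≤ p + 1 ∧
      (p : QuadraticAlgebra (ZMod n) (Δ : ZMod n) 0) ∣ z ^ d - 1 := by
  have hodd := hp.odd_of_ne_two hp2
  have frob := natCast_prime_dvd_pow_sub hp hp2 Δ z
  rcases jacobiSym.trichotomy Δ p with h | h | h
  · exact absurd h hΔ
  · have hp1 := hp.two_le
    refine ⟨p - 1, hodd.tsub_odd odd_one, by omega, by omega, ?_⟩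
    have hf : (⟨z.re, (jacobiSym Δ p : ZMod n) * z.im⟩ :
        QuadraticAlgebra (ZMod n) (Δ : ZMod n) 0) = z := by ext <;> simp [h]
    rw [hf] at frob
    have hpow : z ^ p = z ^ (p - 1) * z := by rw [← pow_succ]; congr 1; omega
    convert frob.mul_right (star z) using 1
    rw [hpow]
    linear_combination (1 - z ^ (p - 1)) * hz
  · refine ⟨p + 1, hodd.add_odd odd_one, by omega, le_rfl, ?_⟩
    have hf : (⟨z.re, (jacobiSym Δ p : ZMod n) * z.im⟩ :
        QuadraticAlgebra (ZMod n) (Δ : ZMod n) 0) = star z := by ext <;> simp [h]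
    rw [hf] at frob
    convert frob.mul_right z using 1
    linear_combination hz

theorem two_mul_prod_primeFactors_le {n : ℕ} (hodd : Odd n) (hn : 1 < n) (hnp : ¬ n.Prime)
    {d : ℕ → ℕ} (hd : ∀ p ∈ n.primeFactors, d p ≤ p + 1) :
    2 * ∏ p ∈ n.primeFactors, d p / 2 ≤ n := by
  have three_le {p : ℕ} (hp : p ∈ n.primeFactors) : 3 ≤ p := by
    have h2 := (Nat.prime_of_mem_primeFactors hp).two_le
    rcases hodd.of_dvd_nat (Nat.dvd_of_mem_primeFactors hp) with ⟨k, hk⟩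
    omega
  obtain ⟨p, hp⟩ := Nat.nonempty_primeFactors.2 hn
  by_cases hq : ∃ q ∈ n.primeFactors, q ≠ p
  · obtain ⟨q, hq, hqp⟩ := hq
    have hq' : q ∈ n.primeFactors.erase p := Finset.mem_erase.2 ⟨hqp, hq⟩
    refine le_trans ?_ (Nat.le_of_dvd (by omega) n.prod_primeFactors_dvd)
    rw [← Finset.mul_prod_erase _ _ hp, ← Finset.mul_prod_erase _ _ hq',
      ← Finset.mul_prod_erase _ (fun x => x) hp, ← Finset.mul_prod_erase _ (fun x => x) hq',
      ← mul_assoc, ← mul_assoc, ← mul_assoc]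
    refine Nat.mul_le_mul ?_ (Finset.prod_le_prod' fun r hr => ?_)
    · have hp3 := three_le hp
      have hq3 := three_le hq
      have hprod : (2 * (d p / 2)) * (2 * (d q / 2)) ≤ (p + 1) * (q + 1) :=
        Nat.mul_le_mul ((Nat.mul_div_le _ _).trans (hd p hp)) ((Nat.mul_div_le _ _).trans (hd q hq))
      nlinarith
    · have hr' := Finset.mem_of_mem_erase (Finset.mem_of_mem_erase hr)
      have := hd r hr'
      have := three_le hr'
      omega
  · push Not at hq
    rw [Finset.eq_singleton_iff_unique_mem.2 ⟨hp, hq⟩, Finset.prod_singleton]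
    have hlt : p < n := lt_of_le_of_ne (Nat.le_of_mem_primeFactors hp) fun h =>
      hnp (h ▸ Nat.prime_of_mem_primeFactors hp)
    have := hd p hp
    omega

/-- A norm-one element of `(ℤ/nℤ)[√Δ]` can only have order `n + 1` if `n` is prime. -/
theorem QuadraticAlgebra.prime_of_orderOf_eq {n : ℕ} (hn : 1 < n) (hodd : Odd n) {Δ : ℤ}
    (hΔ : jacobiSym Δ n ≠ 0) {z : QuadraticAlgebra (ZMod n) (Δ : ZMod n) 0}
    (hz : z * star z = 1) (hord : orderOf z = n + 1) : n.Prime := by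
  by_contra hnp
  let R := QuadraticAlgebra (ZMod n) (Δ : ZMod n) 0
  have key (p : ℕ) : ∃ d, p ∈ n.primeFactors →
      Even d ∧ 0 < d ∧ d ≤ p + 1 ∧ (p : R) ∣ z ^ d - 1 := by
    by_cases hp : p ∈ n.primeFactors
    · have hpp := Nat.prime_of_mem_primeFactors hp
      have hpn := Nat.dvd_of_mem_primeFactors hp
      have hp2 : p ≠ 2 := by
        rintro rfl
        exact (Nat.not_even_iff_odd.2 hodd) (even_iff_two_dvd.2 hpn)
      have hJ : jacobiSym Δ p ≠ 0 := by
        obtain ⟨m, hm⟩ := hpn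
        intro h0
        have hm0 : m ≠ 0 := by rintro rfl; omega
        rw [hm, jacobiSym.mul_right' _ hpp.ne_zero hm0, h0, zero_mul] at hΔ
        exact hΔ rfl
      obtain ⟨d, hd⟩ := exists_natCast_dvd_pow_sub_one hpp hp2 hJ hz
      exact ⟨d, fun _ => hd⟩
    · exact ⟨0, fun h => absurd h hp⟩
  choose d hd using key
  set E := 2 * ∏ p ∈ n.primeFactors, d p / 2
  have hEpos : 0 < E := Nat.mul_pos two_pos <| Finset.prod_pos fun p hp => by
    obtain ⟨⟨k, hk⟩, hpos, -⟩ := hd p hp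
    omega
  have hEle : E ≤ n :=
    two_mul_prod_primeFactors_le hodd hn hnp fun p hp => (hd p hp).2.2.1
  have hrad : ((∏ p ∈ n.primeFactors, p : ℕ) : R) ∣ z ^ E - 1 := by
    rw [Nat.cast_prod]
    refine Finset.prod_dvd_of_coprime (fun p hp q hq hpq => ?_) fun p hp => ?_
    · exact ((Nat.coprime_primes (Nat.prime_of_mem_primeFactors hp)
        (Nat.prime_of_mem_primeFactors hq)).2 hpq).cast
    · have hdvd : d p ∣ E := by
        rw [← Nat.mul_div_cancel' (even_iff_two_dvd.1 (hd p hp).1)]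
        exact Nat.mul_dvd_mul_left 2 (Finset.dvd_prod_of_mem (fun p => d p / 2) hp)
      obtain ⟨c, hc⟩ := hdvd
      rw [hc]
      exact (hd p hp).2.2.2.trans (pow_one_sub_dvd_pow_mul_sub_one z (d p) c)
  set r := ∏ p ∈ n.primeFactors, p
  have hone : z ^ (E * r ^ n) = 1 := by
    have h := dvd_sub_pow_of_dvd_sub hrad n
    have hnr : n ∣ r ^ (n + 1) :=
      (Nat.dvd_prod_primeFactors_pow_self (by omega)).trans (pow_dvd_pow r n.le_succ)
    have h0 : (r : R) ^ (n + 1) = 0 := by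
      obtain ⟨c, hc⟩ := hnr
      rw [← Nat.cast_pow, hc]
      ext <;> simp [R]
    rw [h0, zero_dvd_iff, one_pow, ← pow_mul, sub_eq_zero] at h
    exact h
  have hdvd : n + 1 ∣ E * r ^ n := hord ▸ orderOf_dvd_of_pow_eq_one hone
  have hcop : Nat.Coprime (n + 1) (r ^ n) :=
    ((Nat.coprime_self_add_left.2 (Nat.coprime_one_left n)).coprime_dvd_right
      n.prod_primeFactors_dvd).pow_right n
  have := Nat.le_of_dvd hEpos (hcop.dvd_of_dvd_mul_right hdvd)
  omega

/-- If `Δ` is a nonresidue modulo the odd prime `p`, some norm-one element of `𝔽_p[√Δ]` has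
order `p + 1`. -/
theorem QuadraticAlgebra.exists_orderOf_eq_add_one {p : ℕ} [hp : Fact p.Prime] (hp2 : p ≠ 2)
    {Δ : ℤ} (hJ : jacobiSym Δ p = -1) :
    ∃ z : QuadraticAlgebra (ZMod p) (Δ : ZMod p) 0, z * star z = 1 ∧ orderOf z = p + 1 := by
  have : Fact (∀ r : ZMod p, r ^ 2 ≠ (Δ : ZMod p) + 0 * r) := ⟨fun r hr =>
    ZMod.nonsquare_of_jacobiSym_eq_neg_one hJ ⟨r, by linear_combination -hr⟩⟩
  set K := QuadraticAlgebra (ZMod p) (Δ : ZMod p) 0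
  have frob (z : K) : z ^ p = star z := by
    have h := natCast_prime_dvd_pow_sub hp.out hp2 Δ z
    have hp0 : (p : K) = 0 := by ext <;> simp [K]
    rw [hp0, zero_dvd_iff, sub_eq_zero] at h
    rw [h]
    ext <;> simp [hJ, K]
  have : Finite K := .of_equiv _ (equivProd (Δ : ZMod p) 0).symm
  have hcard : Nat.card Kˣ = (p + 1) * (p - 1) := by
    have hK : Nat.card K = p ^ 2 := by
      rw [Nat.card_congr (equivProd (Δ : ZMod p) 0), Nat.card_prod, Nat.card_zmod, sq]
    rw [Nat.card_units, hK, ← Nat.sq_sub_sq, one_pow]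
  have hp1 : p - 1 ≠ 0 := by have := hp.out.two_le; omega
  obtain ⟨g, hg⟩ := IsCyclic.exists_ofOrder_eq_natCard (α := Kˣ)
  rw [hcard] at hg
  have hord : orderOf (g ^ (p - 1)) = p + 1 := by
    rw [orderOf_pow_of_dvd hp1 (hg ▸ Dvd.intro_left _ rfl), hg,
      Nat.mul_div_cancel _ (Nat.pos_of_ne_zero hp1)]
  refine ⟨((g ^ (p - 1) : Kˣ) : K), ?_, by rw [orderOf_units, hord]⟩
  rw [← frob, ← pow_succ', ← Units.val_pow_eq_pow_val, ← hord, pow_orderOf_eq_one, Units.val_one]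

/-- The coordinates `X = 2 re z`, `Y = 2 im z` on the Pell conic of a norm-one element `z`. -/
def QuadraticAlgebra.pellPoint {n : ℕ} {Δ : ℤ} (z : QuadraticAlgebra (ZMod n) (Δ : ZMod n) 0) :
    ZMod n × ZMod n :=
  (2 * z.re, 2 * z.im)

namespace QuadraticAlgebra

variable {n : ℕ} {Δ : ℤ}

theorem pellPoint_one : pellPoint (1 : QuadraticAlgebra (ZMod n) (Δ : ZMod n) 0) = (2, 0) := by
  simp [pellPoint]

theorem isUnit_two_of_odd (hodd : Odd n) : IsUnit (2 : ZMod n) := by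
  exact_mod_cast (ZMod.isUnit_iff_coprime 2 n).2 hodd.coprime_two_left

theorem pellPoint_bijective (hodd : Odd n) :
    Function.Bijective (pellPoint : QuadraticAlgebra (ZMod n) (Δ : ZMod n) 0 → _) := by
  have h2 := isUnit_two_of_odd hodd
  refine ⟨fun z w h => ?_, fun P => ⟨⟨2⁻¹ * P.1, 2⁻¹ * P.2⟩, ?_⟩⟩
  · exact QuadraticAlgebra.ext (h2.mul_left_cancel (congrArg Prod.fst h))
      (h2.mul_left_cancel (congrArg Prod.snd h))
  · simp [pellPoint, ← mul_assoc, ZMod.mul_inv_of_unit _ h2]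

theorem pellAdd_pellPoint (hodd : Odd n) (z w : QuadraticAlgebra (ZMod n) (Δ : ZMod n) 0) :
    pellAdd n Δ (pellPoint z) (pellPoint w) = pellPoint (z * w) := by
  have h2 := ZMod.mul_inv_of_unit _ (isUnit_two_of_odd hodd)
  ext <;> simp only [pellAdd, pellPoint, re_mul, im_mul]
  · linear_combination 2 * (z.re * w.re + Δ * z.im * w.im) * h2
  · linear_combination 2 * (z.re * w.im + z.im * w.re) * h2

theorem iterate_pellAdd_pellPoint (hodd : Odd n) (z : QuadraticAlgebra (ZMod n) (Δ : ZMod n) 0)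
    (m : ℕ) : (pellAdd n Δ (pellPoint z))^[m] (2, 0) = pellPoint (z ^ m) := by
  induction m with
  | zero => simp [pellPoint_one]
  | succ m ih => rw [Function.iterate_succ_apply', ih, pellAdd_pellPoint hodd, pow_succ']

theorem iterate_pellAdd_pellPoint_eq_iff (hodd : Odd n)
    (z : QuadraticAlgebra (ZMod n) (Δ : ZMod n) 0) (m : ℕ) :
    (pellAdd n Δ (pellPoint z))^[m] (2, 0) = (2, 0) ↔ z ^ m = 1 := by
  rw [iterate_pellAdd_pellPoint hodd, ← pellPoint_one (Δ := Δ),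
    (pellPoint_bijective hodd).injective.eq_iff]

theorem pellPoint_mem_conic_iff (hodd : Odd n) (z : QuadraticAlgebra (ZMod n) (Δ : ZMod n) 0) :
    (pellPoint z).1 ^ 2 - (Δ : ZMod n) * (pellPoint z).2 ^ 2 = 4 ↔ z * star z = 1 := by
  have h4 : IsUnit (2 ^ 2 : ZMod n) := (isUnit_two_of_odd hodd).pow 2
  rw [← algebraMap_norm_eq_mul_star, ← map_one (algebraMap (ZMod n) _), algebraMap_inj,
    ← h4.mul_right_inj (c := 1), norm_def]
  simp only [pellPoint]
  constructor <;> intro h <;> linear_combination h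

end QuadraticAlgebra

/-- Primality test on Pell conics: let `n ≥ 5` be odd and `Δ` an integer with Jacobi
symbol `(Δ/n) = -1`. Then `n` is prime if and only if there is a point `P` on the Pell
conic `X² - ΔY² = 4` over `ℤ/nℤ` with `(n+1)·P = N` and `((n+1)/r)·P ≠ N` for every
prime `r` dividing `n+1`, where `m·P` is the `m`-fold iterated addition of `P` to the
neutral element `N = (2,0)`. -/
theorem pell_conic_primality_test (n : ℕ) (hn : 5 ≤ n) (hodd : Odd n)
    (Δ : ℤ) (hJ : jacobiSym Δ n = -1) :
    n.Prime ↔ ∃ P : ZMod n × ZMod n, P.1 ^ 2 - (Δ : ZMod n) * P.2 ^ 2 = 4 ∧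
      (pellAdd n Δ P)^[n + 1] (2, 0) = (2, 0) ∧
      ∀ r : ℕ, r.Prime → r ∣ n + 1 → (pellAdd n Δ P)^[(n + 1) / r] (2, 0) ≠ (2, 0) := by
  have hconic := QuadraticAlgebra.pellPoint_mem_conic_iff (Δ := Δ) hodd
  have hiter := QuadraticAlgebra.iterate_pellAdd_pellPoint_eq_iff (Δ := Δ) hodd
  constructor
  · intro hp
    have : Fact n.Prime := ⟨hp⟩
    obtain ⟨z, hz, hord⟩ := QuadraticAlgebra.exists_orderOf_eq_add_one (by omega) hJ
    refine ⟨z.pellPoint, (hconic z).2 hz, (hiter z _).2 (hord ▸ pow_orderOf_eq_one z),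
      fun r hr hrn => (hiter z _).not.2 ?_⟩
    exact pow_ne_one_of_lt_orderOf (Nat.div_pos (Nat.le_of_dvd n.succ_pos hrn) hr.pos).ne'
      ((Nat.div_lt_self n.succ_pos hr.one_lt).trans_eq hord.symm)
  · rintro ⟨P, hP, hone, hne⟩
    obtain ⟨z, rfl⟩ := (QuadraticAlgebra.pellPoint_bijective (Δ := Δ) hodd).surjective P
    refine QuadraticAlgebra.prime_of_orderOf_eq (by omega) hodd (by simp [hJ]) ((hconic z).1 hP) ?_
    exact orderOf_eq_of_pow_and_pow_div_prime n.succ_pos ((hiter z _).1 hone)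
      fun r hr hrn => (hiter z _).not.1 (hne r hr hrn)
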